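/- Let q_1,…,q_n be a circular solution of the planar n-body system in which all masses are equal, m_1 = … = m_n = m for a single everywhere-positive function m : ℝ → ℝ, and let I ⊆ ℝ be an interval such that for all t ∈ I and all j ∈ {1,…,n} (with θ_{n+1} := θ_1 + 2π) one has θ_{j+1}(t) − θ_j(t) ≥ θ_2(t) − θ_1(t). Then the function t ↦ r(t)²·(θ_2'(t) − θ_1'(t)) is non-increasing on I. -/

import Mathlib

open Real

/-- For a planar curve in polar coordinates, the derivative of the angular momentum is the torque. -/
lemma hasDerivAt_sq_mul_deriv_angle {r φ : ℝ → ℝ} {q : ℝ → ℝ × ℝ}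
    (hr : ContDiff ℝ 2 r) (hφ : ContDiff ℝ 2 φ)
    (hq : ∀ t, q t = (r t * cos (φ t), r t * sin (φ t))) (t : ℝ) :
    HasDerivAt (fun t => r t ^ 2 * deriv φ t)
      (r t * cos (φ t) * (deriv (deriv q) t).2 - r t * sin (φ t) * (deriv (deriv q) t).1) t := by
  have hq_eq : q = fun t => (r t * cos (φ t), r t * sin (φ t)) := funext hq
  have hq2 : ContDiff ℝ 2 q := by
    rw [hq_eq]
    exact (hr.mul hφ.cos).prodMk (hr.mul hφ.sin)
  have hqd : HasDerivAt q (deriv q t) t :=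
    (hq2.differentiable (by norm_num) t).hasDerivAt
  have hqdd : HasDerivAt (deriv q) (deriv (deriv q) t) t :=
    (hq2.differentiable_deriv_two t).hasDerivAt
  have hderiv (s : ℝ) : deriv q s =
      (deriv r s * cos (φ s) + r s * (-sin (φ s) * deriv φ s),
        deriv r s * sin (φ s) + r s * (cos (φ s) * deriv φ s)) := by
    have hrs := (hr.differentiable (by norm_num) s).hasDerivAt
    have hφs := (hφ.differentiable (by norm_num) s).hasDerivAt
    rw [hq_eq]
    exact ((hrs.mul hφs.cos).prodMk (hrs.mul hφs.sin)).deriv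
  have hL : (fun t => r t ^ 2 * deriv φ t) =
      fun t => (q t).1 * (deriv q t).2 - (q t).2 * (deriv q t).1 := by
    funext s
    rw [hderiv, hq]
    linear_combination (-r s ^ 2 * deriv φ s) * sin_sq_add_cos_sq (φ s)
  rw [hL]
  have hfst {p : ℝ → ℝ × ℝ} {p' : ℝ × ℝ} (hp : HasDerivAt p p' t) :
      HasDerivAt (fun s => (p s).1) p'.1 t :=
    hp.hasFDerivAt.fst.hasDerivAt.congr_deriv (by simp)
  have hsnd {p : ℝ → ℝ × ℝ} {p' : ℝ × ℝ} (hp : HasDerivAt p p' t) :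
      HasDerivAt (fun s => (p s).2) p'.2 t :=
    hp.hasFDerivAt.snd.hasDerivAt.congr_deriv (by simp)
  have h := ((hfst hqd).mul (hsnd hqdd)).sub ((hsnd hqd).mul (hfst hqdd))
  refine h.congr_deriv ?_
  rw [hq]
  ring

/-- Tangential force, divided by `m * r`, exerted on a body of a circular configuration of radius
`ρ` by a body whose angular position is larger by `α`. -/
noncomputable def tangentialForce (f : ℝ → ℝ) (ρ α : ℝ) : ℝ :=
  sin α * f (ρ ^ 2 * (2 - 2 * cos α))

lemma tangentialForce_add_two_pi (f : ℝ → ℝ) (ρ α : ℝ) :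
    tangentialForce f ρ (α + 2 * π) = tangentialForce f ρ α := by
  simp [tangentialForce]

lemma tangentialForce_two_pi_sub (f : ℝ → ℝ) (ρ α : ℝ) :
    tangentialForce f ρ (2 * π - α) = -tangentialForce f ρ α := by
  simp [tangentialForce, sin_two_pi_sub, cos_two_pi_sub]

lemma two_sub_two_mul_cos_pos {α : ℝ} (h0 : 0 < α) (h1 : α < 2 * π) : 0 < 2 - 2 * cos α := by
  have hs : 0 < sin (α / 2) := sin_pos_of_pos_of_lt_pi (by linarith) (by linarith)
  have hc : cos α = 1 - 2 * sin (α / 2) ^ 2 := by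
    have h := cos_two_mul (α / 2)
    rw [show 2 * (α / 2) = α by ring] at h
    linear_combination h + 2 * sin_sq_add_cos_sq (α / 2)
  rw [hc]
  nlinarith [pow_pos hs 2]

lemma mul_tangentialForce (f : ℝ → ℝ) {ρ α : ℝ} (hρ : 0 < ρ) (h0 : 0 < α) (h1 : α < 2 * π) :
    ρ * tangentialForce f ρ α =
      cos (α / 2) * (√(ρ ^ 2 * (2 - 2 * cos α)) * f (ρ ^ 2 * (2 - 2 * cos α))) := by
  have hs : 0 < sin (α / 2) := sin_pos_of_pos_of_lt_pi (by linarith) (by linarith)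
  have hsq : √(ρ ^ 2 * (2 - 2 * cos α)) = 2 * ρ * sin (α / 2) := by
    rw [← sqrt_sq (by positivity : 0 ≤ 2 * ρ * sin (α / 2))]
    congr 1
    have hc : cos α = 2 * cos (α / 2) ^ 2 - 1 := by
      rw [← cos_two_mul]
      ring_nf
    rw [hc]
    linear_combination (-4 * ρ ^ 2) * sin_sq_add_cos_sq (α / 2)
  have hsin : sin α = 2 * sin (α / 2) * cos (α / 2) := by
    rw [← sin_two_mul]
    ring_nf
  rw [hsq, tangentialForce, hsin]
  ring

lemma tangentialForce_nonneg {f : ℝ → ℝ} (hf_pos : ∀ x > 0, 0 < f x) {ρ α : ℝ} (hρ : 0 < ρ)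
    (h0 : 0 < α) (h1 : α ≤ π) : 0 ≤ tangentialForce f ρ α :=
  mul_nonneg (sin_nonneg_of_nonneg_of_le_pi h0.le h1)
    (hf_pos _ (mul_pos (by positivity)
      (two_sub_two_mul_cos_pos h0 (by linarith [pi_pos])))).le

lemma tangentialForce_antitoneOn_Ioc {f : ℝ → ℝ} (hf_pos : ∀ x > 0, 0 < f x)
    (hf_dec : AntitoneOn (fun x => √x * f x) (Set.Ioi 0)) {ρ : ℝ} (hρ : 0 < ρ) :
    AntitoneOn (tangentialForce f ρ) (Set.Ioc 0 π) := by
  rintro α ⟨ha0, ha1⟩ β ⟨hb0, hb1⟩ hab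
  have hpi := pi_pos
  have hxα : 0 < ρ ^ 2 * (2 - 2 * cos α) :=
    mul_pos (by positivity) (two_sub_two_mul_cos_pos ha0 (by linarith))
  have hxβ : 0 < ρ ^ 2 * (2 - 2 * cos β) :=
    mul_pos (by positivity) (two_sub_two_mul_cos_pos hb0 (by linarith))
  have hcos : cos β ≤ cos α := cos_le_cos_of_nonneg_of_le_pi ha0.le hb1 hab
  have hle : ρ ^ 2 * (2 - 2 * cos α) ≤ ρ ^ 2 * (2 - 2 * cos β) := by gcongr
  refine le_of_mul_le_mul_left ?_ hρ
  rw [mul_tangentialForce f hρ ha0 (by linarith), mul_tangentialForce f hρ hb0 (by linarith)]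
  exact mul_le_mul (cos_le_cos_of_nonneg_of_le_pi (by linarith) (by linarith) (by linarith))
    (hf_dec hxα hxβ hle) (mul_nonneg (sqrt_nonneg _) (hf_pos _ hxβ).le)
    (cos_nonneg_of_neg_pi_div_two_le_of_le (by linarith) (by linarith))

lemma tangentialForce_antitoneOn {f : ℝ → ℝ} (hf_pos : ∀ x > 0, 0 < f x)
    (hf_dec : AntitoneOn (fun x => √x * f x) (Set.Ioi 0)) {ρ : ℝ} (hρ : 0 < ρ) :
    AntitoneOn (tangentialForce f ρ) (Set.Ioo 0 (2 * π)) := by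
  rintro α ⟨ha0, ha1⟩ β ⟨hb0, hb1⟩ hab
  have hanti := tangentialForce_antitoneOn_Ioc hf_pos hf_dec hρ
  have hα := tangentialForce_two_pi_sub f ρ α
  have hβ := tangentialForce_two_pi_sub f ρ β
  rcases le_total β π with hb | hb
  · exact hanti ⟨ha0, hab.trans hb⟩ ⟨hb0, hb⟩ hab
  have hβ_nonneg : 0 ≤ tangentialForce f ρ (2 * π - β) :=
    tangentialForce_nonneg hf_pos hρ (by linarith) (by linarith)
  rcases le_total α π with ha | ha
  · linarith [tangentialForce_nonneg hf_pos hρ ha0 ha]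
  · have h := @hanti (2 * π - β) ⟨by linarith, by linarith⟩ (2 * π - α)
      ⟨by linarith, by linarith⟩ (by linarith)
    linarith

/-- The torque on body `i` in a circular configuration. -/
lemma torque_eq_sum_tangentialForce {n i : ℕ} {f : ℝ → ℝ} {μ ρ : ℝ} {φ : ℕ → ℝ} {p : ℕ → ℝ × ℝ}
    {a : ℝ × ℝ} (hi : i < n) (hp : ∀ j < n, p j = (ρ * cos (φ j), ρ * sin (φ j)))
    (ha : a = ∑ j ∈ (Finset.range n).erase i,
      (μ * f (((p j).1 - (p i).1) ^ 2 + ((p j).2 - (p i).2) ^ 2)) • (p j - p i)) :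
    ρ * cos (φ i) * a.2 - ρ * sin (φ i) * a.1 =
      ρ ^ 2 * μ * ∑ j ∈ (Finset.range n).erase i, tangentialForce f ρ (φ j - φ i) := by
  rw [ha, Prod.fst_sum, Prod.snd_sum, Finset.mul_sum, Finset.mul_sum, Finset.mul_sum,
    ← Finset.sum_sub_distrib]
  refine Finset.sum_congr rfl fun j hj => ?_
  have hj : j < n := Finset.mem_range.mp (Finset.mem_of_mem_erase hj)
  have hdist : ((p j).1 - (p i).1) ^ 2 + ((p j).2 - (p i).2) ^ 2 =
      ρ ^ 2 * (2 - 2 * cos (φ j - φ i)) := by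
    rw [hp j hj, hp i hi, cos_sub]
    linear_combination ρ ^ 2 * sin_sq_add_cos_sq (φ j) + ρ ^ 2 * sin_sq_add_cos_sq (φ i)
  rw [hdist, tangentialForce, hp j hj, hp i hi, sin_sub]
  simp only [Prod.smul_fst, Prod.smul_snd, Prod.fst_sub, Prod.snd_sub, smul_eq_mul]
  ring

/-- If the first gap is minimal, the second body is subject to a smaller total tangential force
than the first one. -/
lemma sum_tangentialForce_le {n : ℕ} (hn : 2 ≤ n) {f : ℝ → ℝ} (hf_pos : ∀ x > 0, 0 < f x)
    (hf_dec : AntitoneOn (fun x => √x * f x) (Set.Ioi 0)) {ρ : ℝ} (hρ : 0 < ρ) {φ : ℕ → ℝ}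
    (hord : ∀ i j, i < j → j < n → φ i < φ j) (hord2 : ∀ i < n, φ i < φ 0 + 2 * π)
    (hgap : ∀ j < n, (if j + 1 = n then φ 0 + 2 * π else φ (j + 1)) - φ j ≥ φ 1 - φ 0) :
    ∑ j ∈ (Finset.range n).erase 1, tangentialForce f ρ (φ j - φ 1) ≤
      ∑ j ∈ (Finset.range n).erase 0, tangentialForce f ρ (φ j - φ 0) := by
  obtain ⟨k, rfl⟩ : ∃ k, n = k + 2 := ⟨n - 2, by omega⟩
  have h01 : φ 0 < φ 1 := hord 0 1 (by omega) (by omega)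
  have hanti := tangentialForce_antitoneOn hf_pos hf_dec hρ
  have herase1 : ∑ j ∈ (Finset.range (k + 2)).erase 1, tangentialForce f ρ (φ j - φ 1) =
      ∑ j ∈ Finset.range k, tangentialForce f ρ (φ (j + 2) - φ 1) +
        tangentialForce f ρ (φ 0 + 2 * π - φ 1) := by
    have h := Finset.add_sum_erase (Finset.range (k + 2))
      (fun j => tangentialForce f ρ (φ j - φ 1)) (a := 1) (by simp)
    rw [Finset.sum_range_succ', Finset.sum_range_succ'] at h
    have hper := tangentialForce_add_two_pi f ρ (φ 0 - φ 1)
    rw [sub_add_eq_add_sub] at hper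
    rw [hper]
    simp only [zero_add, add_assoc, Nat.reduceAdd] at h ⊢
    linarith
  have herase0 : ∑ j ∈ (Finset.range (k + 2)).erase 0, tangentialForce f ρ (φ j - φ 0) =
      ∑ j ∈ Finset.range k, tangentialForce f ρ (φ (j + 1) - φ 0) +
        tangentialForce f ρ (φ (k + 1) - φ 0) := by
    have h := Finset.add_sum_erase (Finset.range (k + 2))
      (fun j => tangentialForce f ρ (φ j - φ 0)) (a := 0) (by simp)
    rw [Finset.sum_range_succ', Finset.sum_range_succ] at h
    linarith
  rw [herase1, herase0]
  refine add_le_add (Finset.sum_le_sum fun j hj => ?_) ?_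
  · have hj := Finset.mem_range.mp hj
    have hg := hgap (j + 1) (by omega)
    rw [if_neg (by omega), add_assoc] at hg
    have h1 := hord 0 (j + 1) (by omega) (by omega)
    have h2 := hord2 (j + 2) (by omega)
    exact hanti ⟨by linarith, by linarith [hord2 (j + 1) (by omega)]⟩
      ⟨by linarith [hord 1 (j + 2) (by omega) (by omega)], by linarith⟩ (by linarith)
  · have hg := hgap (k + 1) (by omega)
    rw [if_pos rfl] at hg
    have h1 := hord 0 (k + 1) (by omega) (by omega)
    exact hanti ⟨by linarith, by linarith [hord2 (k + 1) (by omega)]⟩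
      ⟨by linarith [hord2 1 (by omega)], by linarith⟩ (by linarith)

/-- For a circular solution of the planar `n`-body problem with all masses
equal to a single everywhere-positive function `m`, if on an interval `I` all angular
gaps are at least the first gap (with `θ_n := θ₀ + 2π`; bodies are indexed by
`i ∈ {0, …, n-1}`), then `t ↦ r(t)²(θ₁'(t) − θ₀'(t))` is non-increasing on `I`. -/
theorem circular_weighted_gap_derivative_antitone
    (n : ℕ) (hn : 2 ≤ n)
    -- the kernel `f`: positive on `(0,∞)`, with `x ↦ √x · f x` decreasing on `(0,∞)`
    (f : ℝ → ℝ) (hf_pos : ∀ x > 0, 0 < f x)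
    (hf_dec : AntitoneOn (fun x => Real.sqrt x * f x) (Set.Ioi 0))
    -- the common mass function, everywhere positive
    (m : ℝ → ℝ) (hm : ∀ t, 0 < m t)
    -- the radius, twice continuously differentiable and positive
    (r : ℝ → ℝ) (hr : ContDiff ℝ 2 r) (hr_pos : ∀ t, 0 < r t)
    -- the angles, twice continuously differentiable and ordered
    (θ : ℕ → ℝ → ℝ) (hθ : ∀ i < n, ContDiff ℝ 2 (θ i))
    (hord : ∀ t, ∀ i j, i < j → j < n → θ i t < θ j t)
    (hord2 : ∀ t, ∀ i < n, θ i t < θ 0 t + 2 * π)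
    -- the bodies, lying on a circle of radius `r`
    (q : ℕ → ℝ → ℝ × ℝ)
    (hq : ∀ i < n, ∀ t, q i t = (r t * Real.cos (θ i t), r t * Real.sin (θ i t)))
    -- the equations of motion
    (hODE : ∀ i < n, ∀ t, deriv (deriv (q i)) t =
      ∑ j ∈ (Finset.range n).erase i,
        (m t * f (((q j t).1 - (q i t).1) ^ 2 + ((q j t).2 - (q i t).2) ^ 2)) •
          (q j t - q i t))
    -- an interval on which the gap condition holds
    (I : Set ℝ) (hI : I.OrdConnected)
    (hgap : ∀ t ∈ I, ∀ j < n,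
      (if j + 1 = n then θ 0 t + 2 * π else θ (j + 1) t) - θ j t ≥ θ 1 t - θ 0 t) :
    AntitoneOn (fun t => r t ^ 2 * (deriv (θ 1) t - deriv (θ 0) t)) I := by
  have hL (t : ℝ) (i : ℕ) (hi : i < n) : HasDerivAt (fun t => r t ^ 2 * deriv (θ i) t)
      (r t ^ 2 * m t * ∑ j ∈ (Finset.range n).erase i,
        tangentialForce f (r t) (θ j t - θ i t)) t :=
    (hasDerivAt_sq_mul_deriv_angle hr (hθ i hi) (hq i hi) t).congr_deriv
      (torque_eq_sum_tangentialForce (φ := fun j => θ j t) (p := fun j => q j t) hi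
        (fun j hj => hq j hj t) (hODE i hi t))
  have hD (t : ℝ) := ((hL t 1 (by omega)).sub (hL t 0 (by omega))).congr_of_eventuallyEq
    (f₁ := fun t => r t ^ 2 * (deriv (θ 1) t - deriv (θ 0) t))
    (Filter.Eventually.of_forall fun s => mul_sub _ _ _)
  refine antitoneOn_of_deriv_nonpos hI.convex
    (fun t _ => (hD t).continuousAt.continuousWithinAt)
    (fun t _ => (hD t).differentiableAt.differentiableWithinAt) fun t ht => ?_
  rw [(hD t).deriv, sub_nonpos]
  exact mul_le_mul_of_nonneg_left
    (sum_tangentialForce_le (φ := fun j => θ j t) hn hf_pos hf_dec (hr_pos t) (hord t) (hord2 t)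
      (hgap t (interior_subset ht)))
    (mul_nonneg (sq_nonneg _) (hm t).le)
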